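/- arXiv:1702.02405 — 2 statements merged into one kernel-verified Lean document; each statement's English description precedes it below -/
import Mathlib

section
/- Let k ≥ 1 and t ≥ k. Suppose E contains no run of k consecutive edges, let ALG be a t-locally-optimal consecutive matching in E, and let OPT be any consecutive matching in E. Then every streak s of OPT has balance at least −2 (with respect to the credit scheme determined by ALG and OPT). -/
/-- Two edges `(i,j)` and `(i',j')` of the bipartite graph overlap if
`|i - i'| ≤ 1` or `|j - j'| ≤ 1`. -/
def Overlap {n : ℕ} (e e' : Fin n × Fin n) : Prop :=
  ((e.1.val : ℤ) - e'.1.val).natAbs ≤ 1 ∨ ((e.2.val : ℤ) - e'.2.val).natAbs ≤ 1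

instance {n : ℕ} (e e' : Fin n × Fin n) : Decidable (Overlap e e') := by
  unfold Overlap; infer_instance

/-- `M` is a consecutive matching in `E`. -/
def ConsecMatching {n : ℕ} (E M : Finset (Fin n × Fin n)) : Prop :=
  M ⊆ E ∧
  (∀ e ∈ M, ∀ e' ∈ M, e ≠ e' → e.1 ≠ e'.1 ∧ e.2 ≠ e'.2) ∧
  (∀ e ∈ M, ∀ e' ∈ M, e'.1.val = e.1.val + 1 → e'.2.val = e.2.val + 1) ∧
  (∀ e ∈ M, ∀ e' ∈ M, e'.2.val = e.2.val + 1 → e'.1.val = e.1.val + 1)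

/-- `s` is the run of `ℓ` consecutive edges at `(p, q)`,
i.e. `s = {(p+r, q+r) : 0 ≤ r < ℓ}`. -/
def IsRunAt {n : ℕ} (s : Finset (Fin n × Fin n)) (p q ℓ : ℕ) : Prop :=
  p + ℓ ≤ n ∧ q + ℓ ≤ n ∧
  ∀ e : Fin n × Fin n, e ∈ s ↔ ∃ r < ℓ, e.1.val = p + r ∧ e.2.val = q + r

/-- `s` is a run of `ℓ` consecutive edges. -/
def IsRun {n : ℕ} (s : Finset (Fin n × Fin n)) (ℓ : ℕ) : Prop :=
  ∃ p q, IsRunAt s p q ℓ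

/-- `E` contains no run of `k` consecutive edges. -/
def NoRun {n : ℕ} (E : Finset (Fin n × Fin n)) (k : ℕ) : Prop :=
  ¬ ∃ s : Finset (Fin n × Fin n), IsRun s k ∧ s ⊆ E

/-- `s` is a streak of `M`: a run of (at least one) consecutive edges contained in `M`,
maximal under inclusion among runs contained in `M`. -/
def IsStreak {n : ℕ} (M s : Finset (Fin n × Fin n)) : Prop :=
  (∃ ℓ, 1 ≤ ℓ ∧ IsRun s ℓ) ∧ s ⊆ M ∧
  ∀ s' ℓ', IsRun s' ℓ' → s' ⊆ M → s ⊆ s' → s' = s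

/-- `s 0, …, s (m-1)` is a greedy sequence in `E` with threshold `k`:
each `s i` is a run of at least `k` consecutive edges, all of whose edges
overlap no edge of the previously chosen runs, and no run of consecutive
edges all still available at step `i` is longer than `s i`. -/
def GreedySeq {n : ℕ} (E : Finset (Fin n × Fin n)) (k m : ℕ)
    (s : ℕ → Finset (Fin n × Fin n)) : Prop :=
  ∀ i < m,
    s i ⊆ E.filter (fun e => ∀ j < i, ∀ e' ∈ s j, ¬ Overlap e e') ∧
    (∃ ℓ, k ≤ ℓ ∧ IsRun (s i) ℓ) ∧
    (∀ r ℓ, IsRun r ℓ →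
      r ⊆ E.filter (fun e => ∀ j < i, ∀ e' ∈ s j, ¬ Overlap e e') →
      ℓ ≤ (s i).card)

/-- `M` is a `t`-locally-optimal consecutive matching in `E`. -/
def LocallyOptimal {n : ℕ} (E M : Finset (Fin n × Fin n)) (t : ℕ) : Prop :=
  ConsecMatching E M ∧
  ¬ ∃ Erem Eadd : Finset (Fin n × Fin n), Erem ⊆ M ∧ Eadd ⊆ E \ M ∧
      Erem.card < Eadd.card ∧ Eadd.card ≤ t ∧
      ConsecMatching E ((M \ Erem) ∪ Eadd)


/-- The credit of the endpoint slot at node `v` on side A of an `ALG` edge is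
transferred to the `OPT` edge `e`:  if some `OPT` edge has its A-endpoint at `v`,
that edge gets the credit; otherwise, if exactly one of `v-1`, `v+1` is the
A-endpoint of an `OPT` edge, that edge gets the credit. -/
def TransfersA {n : ℕ} (OPT : Finset (Fin n × Fin n)) (v : ℕ) (e : Fin n × Fin n) : Prop :=
  e.1.val = v ∨
  ((∀ f ∈ OPT, f.1.val ≠ v) ∧
    ((e.1.val + 1 = v ∧ ∀ f ∈ OPT, f.1.val ≠ v + 1) ∨
     (e.1.val = v + 1 ∧ ∀ f ∈ OPT, f.1.val + 1 ≠ v)))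

/-- Side-B analogue of `TransfersA`. -/
def TransfersB {n : ℕ} (OPT : Finset (Fin n × Fin n)) (v : ℕ) (e : Fin n × Fin n) : Prop :=
  e.2.val = v ∨
  ((∀ f ∈ OPT, f.2.val ≠ v) ∧
    ((e.2.val + 1 = v ∧ ∀ f ∈ OPT, f.2.val ≠ v + 1) ∨
     (e.2.val = v + 1 ∧ ∀ f ∈ OPT, f.2.val + 1 ≠ v)))

instance {n : ℕ} (OPT : Finset (Fin n × Fin n)) (v : ℕ) (e : Fin n × Fin n) :
    Decidable (TransfersA OPT v e) := by unfold TransfersA; infer_instance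

instance {n : ℕ} (OPT : Finset (Fin n × Fin n)) (v : ℕ) (e : Fin n × Fin n) :
    Decidable (TransfersB OPT v e) := by unfold TransfersB; infer_instance

/-- The number of endpoint slots of `ALG` edges whose credit is transferred to `e`. -/
def credits {n : ℕ} (ALG OPT : Finset (Fin n × Fin n)) (e : Fin n × Fin n) : ℕ :=
  (ALG.filter (fun a => TransfersA OPT a.1.val e)).card +
  (ALG.filter (fun a => TransfersB OPT a.2.val e)).card

/-- The balance of a set `S` of `OPT` edges: total credits received minus `|S|`. -/
def balance {n : ℕ} (ALG OPT S : Finset (Fin n × Fin n)) : ℤ :=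
  (∑ e ∈ S, (credits ALG OPT e : ℤ)) - S.card

theorem ConsecMatching.mono {n : ℕ} {E M S : Finset (Fin n × Fin n)}
    (hM : ConsecMatching E M) (hS : S ⊆ M) : ConsecMatching E S := by
  obtain ⟨h1, h2, h3, h4⟩ := hM
  exact ⟨hS.trans h1, fun e he e' he' => h2 e (hS he) e' (hS he'),
    fun e he e' he' => h3 e (hS he) e' (hS he'), fun e he e' he' => h4 e (hS he) e' (hS he')⟩

theorem Overlap.symm {n : ℕ} {e e' : Fin n × Fin n} (h : Overlap e e') : Overlap e' e := by
  unfold Overlap at *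
  omega

/-- The union of two consecutive matchings without overlaps between them is a consecutive
matching. -/
theorem ConsecMatching.union {n : ℕ} {E M N : Finset (Fin n × Fin n)}
    (hM : ConsecMatching E M) (hN : ConsecMatching E N)
    (hMN : ∀ a ∈ M, ∀ e ∈ N, ¬ Overlap a e) : ConsecMatching E (M ∪ N) := by
  obtain ⟨hM1, hM2, hM3, hM4⟩ := hM
  obtain ⟨hN1, hN2, hN3, hN4⟩ := hN
  have key : ∀ e ∈ M ∪ N, ∀ e' ∈ M ∪ N,
      (e ∈ M ∧ e' ∈ M) ∨ (e ∈ N ∧ e' ∈ N) ∨ ¬ Overlap e e' := by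
    intro e he e' he'
    rcases Finset.mem_union.1 he with h | h <;> rcases Finset.mem_union.1 he' with h' | h'
    · exact Or.inl ⟨h, h'⟩
    · exact Or.inr (Or.inr (hMN e h e' h'))
    · exact Or.inr (Or.inr fun o => hMN e' h' e h o.symm)
    · exact Or.inr (Or.inl ⟨h, h'⟩)
  refine ⟨Finset.union_subset hM1 hN1, ?_, ?_, ?_⟩ <;> intro e he e' he' hee
  · rcases key e he e' he' with ⟨h, h'⟩ | ⟨h, h'⟩ | h
    · exact hM2 e h e' h' hee
    · exact hN2 e h e' h' hee
    · constructor <;> intro heq <;> exact h (by simp [Overlap, heq])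
  · rcases key e he e' he' with ⟨h, h'⟩ | ⟨h, h'⟩ | h
    · exact hM3 e h e' h' hee
    · exact hN3 e h e' h' hee
    · exact absurd (Or.inl (by omega)) h
  · rcases key e he e' he' with ⟨h, h'⟩ | ⟨h, h'⟩ | h
    · exact hM4 e h e' h' hee
    · exact hN4 e h e' h' hee
    · exact absurd (Or.inr (by omega)) h

/-- A consecutive matching of size at most `t` is overlapped by at least as many edges of a
`t`-locally-optimal one. -/
theorem LocallyOptimal.card_le_card_overlap {n : ℕ} {E ALG S : Finset (Fin n × Fin n)} {t : ℕ}
    (hALG : LocallyOptimal E ALG t) (hS : ConsecMatching E S) (hcard : S.card ≤ t) :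
    S.card ≤ (ALG.filter fun a => ∃ e ∈ S, Overlap a e).card := by
  obtain ⟨hM, hopt⟩ := hALG
  by_contra! hlt
  set R := ALG.filter fun a => ∃ e ∈ S, Overlap a e with hR
  have hself : ALG ∩ S ⊆ R := by
    intro a ha
    rw [Finset.mem_inter] at ha
    exact Finset.mem_filter.2 ⟨ha.1, a, ha.2, by simp [Overlap]⟩
  have hunion : ALG \ (R \ S) ∪ S \ ALG = ALG \ R ∪ S := by
    ext a
    have := @hself a
    simp only [Finset.mem_union, Finset.mem_sdiff, Finset.mem_inter] at this ⊢
    tauto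
  refine hopt ⟨R \ S, S \ ALG, ?_, ?_, ?_, ?_, ?_⟩
  · exact Finset.sdiff_subset.trans (Finset.filter_subset _ _)
  · exact Finset.sdiff_subset_sdiff hS.1 subset_rfl
  · have hRS : R ∩ S = ALG ∩ S := by
      ext a
      have := @hself a
      simp only [hR, Finset.mem_inter, Finset.mem_filter] at this ⊢
      tauto
    have h1 := Finset.card_sdiff_add_card_inter R S
    have h2 := Finset.card_sdiff_add_card_inter S ALG
    rw [Finset.inter_comm S ALG] at h2
    rw [hRS] at h1
    omega
  · exact (Finset.card_le_card Finset.sdiff_subset).trans hcard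
  · rw [hunion]
    refine (hM.mono Finset.sdiff_subset).union hS ?_
    intro a ha e he ho
    rw [Finset.mem_sdiff] at ha
    exact ha.2 (Finset.mem_filter.2 ⟨ha.1, e, he, ho⟩)

theorem credits_pos_of_endpoint_eq {n : ℕ} {ALG : Finset (Fin n × Fin n)}
    (OPT : Finset (Fin n × Fin n)) {a e : Fin n × Fin n} (ha : a ∈ ALG)
    (h : a.1.val = e.1.val ∨ a.2.val = e.2.val) : 0 < credits ALG OPT e := by
  unfold credits
  rcases h with h | h
  · exact Nat.add_pos_left (Finset.card_pos.2 ⟨a, Finset.mem_filter.2 ⟨ha, Or.inl h.symm⟩⟩) _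
  · exact Nat.add_pos_right _ (Finset.card_pos.2 ⟨a, Finset.mem_filter.2 ⟨ha, Or.inl h.symm⟩⟩)

theorem card_le_sum_credits {n : ℕ} {ALG : Finset (Fin n × Fin n)}
    (OPT : Finset (Fin n × Fin n)) {R S : Finset (Fin n × Fin n)} (hR : R ⊆ ALG)
    (h : ∀ a ∈ R, ∃ e ∈ S, a.1.val = e.1.val ∨ a.2.val = e.2.val) :
    R.card ≤ ∑ e ∈ S, credits ALG OPT e := by
  have hsub : R ⊆ S.biUnion fun e =>
      (ALG.filter fun a => TransfersA OPT a.1.val e) ∪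
        (ALG.filter fun a => TransfersB OPT a.2.val e) := by
    intro a ha
    obtain ⟨e, he, hae⟩ := h a ha
    simp only [Finset.mem_biUnion, Finset.mem_union, Finset.mem_filter]
    exact ⟨e, he, hae.imp (fun h => ⟨hR ha, Or.inl h.symm⟩) (fun h => ⟨hR ha, Or.inl h.symm⟩)⟩
  exact (Finset.card_le_card hsub).trans
    (Finset.card_biUnion_le.trans (Finset.sum_le_sum fun e _ => Finset.card_union_le _ _))

theorem IsRunAt.card_eq {n : ℕ} {s : Finset (Fin n × Fin n)} {p q ℓ : ℕ}
    (h : IsRunAt s p q ℓ) : s.card = ℓ := by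
  obtain ⟨hp, hq, hs⟩ := h
  symm
  rw [← Finset.card_range ℓ]
  refine Finset.card_bij (fun r hr => (⟨p + r, by simp at hr; omega⟩, ⟨q + r, by simp at hr; omega⟩))
    ?_ ?_ ?_
  · intro r hr
    exact (hs _).2 ⟨r, Finset.mem_range.1 hr, rfl, rfl⟩
  · intro r _ r' _ h
    simp only [Prod.mk.injEq, Fin.mk.injEq] at h
    omega
  · intro e he
    obtain ⟨r, hr, h1, h2⟩ := (hs e).1 he
    exact ⟨r, Finset.mem_range.2 hr, Prod.ext (Fin.ext h1.symm) (Fin.ext h2.symm)⟩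

theorem NoRun.lt_of_subset {n : ℕ} {E s : Finset (Fin n × Fin n)} {k p q ℓ : ℕ}
    (hE : NoRun E k) (h : IsRunAt s p q ℓ) (hs : s ⊆ E) : ℓ < k := by
  by_contra! hk
  obtain ⟨hp, hq, hmem⟩ := h
  refine hE ⟨s.filter fun e => e.1.val < p + k, ⟨p, q, by omega, by omega, fun e => ?_⟩,
    (Finset.filter_subset _ _).trans hs⟩
  rw [Finset.mem_filter, hmem]
  constructor
  · rintro ⟨⟨r, _, h1, h2⟩, _⟩
    exact ⟨r, by omega, h1, h2⟩
  · rintro ⟨r, hr, h1, h2⟩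
    exact ⟨⟨r, by omega, h1, h2⟩, by omega⟩

/-- The edges strictly between two gaps of a run receive at least as many credits as there are
such edges. -/
theorem card_le_sum_credits_between_gaps {n : ℕ} {E ALG OPT s : Finset (Fin n × Fin n)}
    {t p q ℓ : ℕ} (hALG : LocallyOptimal E ALG t) (hs : ConsecMatching E s)
    (hrun : IsRunAt s p q ℓ) (hℓ : ℓ ≤ t) {g g' : Fin n × Fin n} (hg : g ∈ s) (hg' : g' ∈ s)
    (hg0 : credits ALG OPT g = 0) (hg'0 : credits ALG OPT g' = 0) :
    (s.filter fun e => g.1 < e.1 ∧ e.1 < g'.1).card ≤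
      ∑ e ∈ s.filter (fun e => g.1 < e.1 ∧ e.1 < g'.1), credits ALG OPT e := by
  have hcard := hrun.card_eq
  obtain ⟨hp, hq, hmem⟩ := hrun
  refine (hALG.card_le_card_overlap (hs.mono (Finset.filter_subset _ _)) ?_).trans
    (card_le_sum_credits OPT (Finset.filter_subset _ _) ?_)
  · exact (Finset.card_filter_le _ _).trans (hcard.trans_le hℓ)
  intro a ha
  obtain ⟨ha, e, he, hov⟩ := Finset.mem_filter.1 ha
  obtain ⟨he, hge, heg⟩ := Finset.mem_filter.1 he
  have hag : ¬ (a.1.val = g.1.val ∨ a.2.val = g.2.val) :=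
    fun h => (credits_pos_of_endpoint_eq OPT ha h).ne' hg0
  have hag' : ¬ (a.1.val = g'.1.val ∨ a.2.val = g'.2.val) :=
    fun h => (credits_pos_of_endpoint_eq OPT ha h).ne' hg'0
  obtain ⟨i, hi, hi1, hi2⟩ := (hmem g).1 hg
  obtain ⟨j, hj, hj1, hj2⟩ := (hmem g').1 hg'
  obtain ⟨r, hr, hr1, hr2⟩ := (hmem e).1 he
  simp only [Fin.lt_def] at hge heg
  suffices h : ∃ m, i < m ∧ m < j ∧ (a.1.val = p + m ∨ a.2.val = q + m) by
    obtain ⟨m, him, hmj, hm⟩ := h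
    refine ⟨(⟨p + m, by omega⟩, ⟨q + m, by omega⟩), ?_, hm⟩
    simp only [Finset.mem_filter, hmem, Fin.lt_def]
    exact ⟨⟨m, by omega, rfl, rfl⟩, by omega, by omega⟩
  rcases hov with h | h
  · exact ⟨a.1.val - p, by omega, by omega, by omega⟩
  · exact ⟨a.2.val - q, by omega, by omega, by omega⟩

/-- if `E` contains no run of `k` consecutive edges and `ALG` is a
`t`-locally-optimal consecutive matching in `E` (`t ≥ k ≥ 1`), then every streak
of a consecutive matching `OPT` in `E` has balance at least `-2`. -/
theorem streak_balance_ge_neg_two {n : ℕ} (hn : 1 ≤ n)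
    (E : Finset (Fin n × Fin n)) (k t : ℕ) (hk : 1 ≤ k) (ht : k ≤ t)
    (hE : NoRun E k)
    (ALG OPT : Finset (Fin n × Fin n))
    (hALG : LocallyOptimal E ALG t) (hOPT : ConsecMatching E OPT)
    (s : Finset (Fin n × Fin n)) (hs : IsStreak OPT s) :
    -2 ≤ balance ALG OPT s := by
  obtain ⟨⟨ℓ, -, p, q, hrun⟩, hsub, -⟩ := hs
  have hsE : ConsecMatching E s := hOPT.mono hsub
  have hℓ : ℓ ≤ t := (hE.lt_of_subset hrun hsE.1).le.trans ht
  have hbal : balance ALG OPT s = ∑ e ∈ s, ((credits ALG OPT e : ℤ) - 1) := by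
    simp [balance]
  rw [hbal]
  rcases (s.filter fun e => credits ALG OPT e = 0).eq_empty_or_nonempty with hG | hG
  · rw [Finset.filter_eq_empty_iff] at hG
    have : 0 ≤ ∑ e ∈ s, ((credits ALG OPT e : ℤ) - 1) :=
      Finset.sum_nonneg fun e he => by have := hG he; omega
    omega
  obtain ⟨g, hg, hgmin⟩ := Finset.exists_min_image _ (fun e => e.1) hG
  obtain ⟨g', hg', hgmax⟩ := Finset.exists_max_image _ (fun e => e.1) hG
  rw [Finset.mem_filter] at hg hg'
  have hmid := card_le_sum_credits_between_gaps hALG hsE hrun hℓ hg.1 hg'.1 hg.2 hg'.2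
  rw [← Finset.sum_filter_add_sum_filter_not s (fun e => g.1 < e.1 ∧ e.1 < g'.1)]
  have h1 : 0 ≤ ∑ e ∈ s.filter (fun e => g.1 < e.1 ∧ e.1 < g'.1),
      ((credits ALG OPT e : ℤ) - 1) := by
    rw [Finset.sum_sub_distrib, ← Nat.cast_sum]
    simp only [Finset.sum_const, nsmul_eq_mul, mul_one]
    omega
  have h2 : -2 ≤ ∑ e ∈ s.filter (fun e => ¬ (g.1 < e.1 ∧ e.1 < g'.1)),
      ((credits ALG OPT e : ℤ) - 1) := by
    set T := s.filter (fun e => ¬ (g.1 < e.1 ∧ e.1 < g'.1)) with hT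
    have hgaps : T.filter (fun e => credits ALG OPT e = 0) ⊆ {g, g'} := by
      intro e he
      obtain ⟨he, h0⟩ := Finset.mem_filter.1 he
      obtain ⟨hes, hout⟩ := Finset.mem_filter.1 he
      have hmin := hgmin e (Finset.mem_filter.2 ⟨hes, h0⟩)
      have hmax := hgmax e (Finset.mem_filter.2 ⟨hes, h0⟩)
      rw [Finset.mem_insert, Finset.mem_singleton]
      by_contra! hne
      exact hout ⟨lt_of_le_of_ne hmin (hsE.2.1 g hg.1 e hes hne.1.symm).1,
        lt_of_le_of_ne hmax (hsE.2.1 e hes g' hg'.1 hne.2).1⟩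
    have hcard := (Finset.card_le_card hgaps).trans Finset.card_le_two
    have hle : ∑ e ∈ T, (if credits ALG OPT e = 0 then (-1 : ℤ) else 0) ≤
        ∑ e ∈ T, ((credits ALG OPT e : ℤ) - 1) :=
      Finset.sum_le_sum fun e _ => by split_ifs <;> omega
    rw [← Finset.sum_filter, Finset.sum_const, nsmul_eq_mul] at hle
    omega
  omega
end

section
/- Let ε > 0 and set k = ⌈2/ε⌉ and t = ⌈4/ε⌉ + 1. Suppose E contains no run of k consecutive edges and let M be a t-locally-optimal consecutive matching in E. Then for every consecutive matching O in E one has (2 + ε)·|M| ≥ |O|. -/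
theorem two_mul_sum_le_sum_min_add_one {α : Type*} [DecidableEq α] (T : ℕ) (K : Finset α)
    (σ : α → ℕ) (hσ : ∀ v ∈ K, 2 * σ v ≤ T + 1) (hK : ∑ v ∈ K, min T (2 * σ v) < 2 * T) :
    2 * ∑ v ∈ K, σ v ≤ ∑ v ∈ K, min T (2 * σ v) + 1 := by
  by_cases h : ∃ v ∈ K, T < 2 * σ v
  · obtain ⟨v, hv, hlt⟩ := h
    have hA := Finset.add_sum_erase K (fun u => min T (2 * σ u)) hv
    have hB := Finset.add_sum_erase K σ hv
    have h1 : ∑ u ∈ K.erase v, min T (2 * σ u) = 2 * ∑ u ∈ K.erase v, σ u := by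
      rw [Finset.mul_sum]
      refine Finset.sum_congr rfl fun u hu => ?_
      have := Finset.single_le_sum (f := fun u => min T (2 * σ u)) (fun _ _ => Nat.zero_le _) hu
      omega
    have := hσ v hv
    omega
  · push Not at h
    rw [Finset.mul_sum]
    have : ∑ v ∈ K, min T (2 * σ v) = ∑ v ∈ K, 2 * σ v :=
      Finset.sum_congr rfl fun v hv => min_eq_right (h v hv)
    omega

/-- A local-search bound for hypergraphs. Vertices `v` have a cost `c v ∈ {0, 1}` and a size `σ v`,
hyperedges `s ∈ S` have a vertex set `L s` and a size `d s`, and every subfamily of total size at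
most `T` has at most as many hyperedges as the cost of the vertices it covers. -/
theorem card_le_of_forall_card_le_cost {α ι : Type*} [DecidableEq α] [DecidableEq ι]
    (T : ℕ) (V : Finset α) (L : ι → Finset α) (S : Finset ι) (d : ι → ℕ) (c σ β : α → ℕ)
    (hL : ∀ s ∈ S, L s ⊆ V)
    (hc : ∀ v ∈ V, c v = 0 ∨ (c v = 1 ∧ σ v = 1))
    (hσ : ∀ v ∈ V, c v = 0 → 2 * σ v ≤ T + 1)
    (hdeg : ∀ v ∈ V, (S.filter (fun s => v ∈ L s)).card ≤ β v + 1 + c v)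
    (hS : ∀ A ⊆ S, ∑ v ∈ A.biUnion L, σ v + ∑ s ∈ A, d s ≤ T →
      A.card ≤ ∑ v ∈ A.biUnion L, c v) :
    2 * T * S.card ≤ ∑ v ∈ V, T * (β v + 2 * c v) + 2 * (∑ v ∈ V, σ v + ∑ s ∈ S, d s) := by
  induction hm : S.card generalizing S L c σ β with
  | zero => simp
  | succ m ih =>
  set val : α → ℕ := fun v => if c v = 1 then T else min T (2 * σ v) with hval
  by_cases hgood : ∀ s ∈ S, 2 * T ≤ ∑ v ∈ L s, val v + 2 * d s
  · rw [← hm]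
    have h1 : ∑ s ∈ S, ∑ v ∈ L s, val v
        = ∑ v ∈ V, (S.filter (fun s => v ∈ L s)).card * val v := by
      rw [Finset.sum_comm' (t' := V) (s' := fun v => S.filter (fun s => v ∈ L s))]
      · simp
      · intro s v
        simp only [Finset.mem_filter]
        exact ⟨fun h => ⟨h, hL s h.1 h.2⟩, fun h => h.1⟩
    have h2 : ∑ v ∈ V, (S.filter (fun s => v ∈ L s)).card * val v
        ≤ ∑ v ∈ V, (T * (β v + 2 * c v) + 2 * σ v) := by
      refine Finset.sum_le_sum fun v hv => ?_
      have hd := Nat.mul_le_mul_right (val v) (hdeg v hv)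
      refine hd.trans ?_
      rcases hc v hv with h | ⟨h, -⟩
      · have e1 : val v ≤ T := by simp [hval, h]
        have e2 : val v ≤ 2 * σ v := by simp [hval, h]
        rw [h]
        nlinarith [Nat.mul_le_mul_left (β v) e1]
      · have e1 : val v = T := by simp [hval, h]
        rw [e1, h]
        nlinarith
    have h3 := Finset.sum_le_sum hgood
    rw [Finset.sum_add_distrib, h1, ← Finset.mul_sum] at h3
    rw [Finset.sum_add_distrib, ← Finset.mul_sum] at h2
    simp only [Finset.sum_const, smul_eq_mul] at h3
    rw [← Finset.mul_sum] at h2 h3 ⊢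
    linarith
  push Not at hgood
  obtain ⟨s, hs, hbad⟩ := hgood
  set K := L s with hKdef
  have hKV : K ⊆ V := hL s hs
  have hcle : ∀ v ∈ K, T * c v ≤ val v := by
    intro v hv
    rcases hc v (hKV hv) with h | ⟨h, -⟩ <;> simp [hval, h]
  have hcost : ∑ v ∈ K, c v < 2 := by
    have := Finset.sum_le_sum hcle
    rw [← Finset.mul_sum] at this
    by_contra hcon
    push Not at hcon
    have := Nat.mul_le_mul_left T hcon
    omega
  have hSs := hS {s} (by simpa using hs)
  simp only [Finset.singleton_biUnion, Finset.sum_singleton, Finset.card_singleton] at hSs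
  rw [← hKdef] at hSs
  obtain ⟨v, hvK, hcv⟩ : ∃ v ∈ K, c v = 1 := by
    by_contra hcon
    push Not at hcon
    have hc0 : ∀ v ∈ K, c v = 0 := fun v hv =>
      (hc v (hKV hv)).resolve_right fun h => hcon v hv h.1
    have e1 : ∑ v ∈ K, val v = ∑ v ∈ K, min T (2 * σ v) :=
      Finset.sum_congr rfl fun v hv => by simp [hval, hc0 v hv]
    have e2 := two_mul_sum_le_sum_min_add_one T K σ (fun v hv => hσ v (hKV hv) (hc0 v hv))
      (by omega)
    have := hSs (by omega)
    rw [Finset.sum_eq_zero hc0] at this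
    omega
  have hvV := hKV hvK
  have hsplit := Finset.add_sum_erase K c hvK
  have hc0 : ∀ u ∈ K.erase v, c u = 0 := by
    intro u hu
    have := Finset.single_le_sum (f := c) (fun _ _ => Nat.zero_le _) hu
    omega
  have hcK : ∑ u ∈ K, c u = 1 := by
    have := Finset.sum_eq_zero hc0
    omega
  have hσv : σ v = 1 := by
    rcases hc v hvV with h | h <;> omega
  have hnew : 2 * (∑ u ∈ K, σ u + d s) ≤ T + 1 := by
    have e0 : val v = T := by simp [hval, hcv]
    rw [← Finset.add_sum_erase K val hvK, e0] at hbad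
    have e1 : ∑ u ∈ K.erase v, val u = ∑ u ∈ K.erase v, 2 * σ u := by
      refine Finset.sum_congr rfl fun u hu => ?_
      have h1 := Finset.single_le_sum (f := val) (fun _ _ => Nat.zero_le _) hu
      have h2 : val u = min T (2 * σ u) := by simp [hval, hc0 u hu]
      omega
    rw [e1, ← Finset.mul_sum] at hbad
    rw [← Finset.add_sum_erase K σ hvK, hσv]
    omega
  -- contract the vertices of `s` to the single vertex `v` of cost zero
  let L' : ι → Finset α := fun s' => if Disjoint (L s') K then L s' else insert v (L s' \ K)
  let c' : α → ℕ := fun u => if u ∈ K then 0 else c u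
  let σ' : α → ℕ := fun u => if u = v then ∑ w ∈ K, σ w + d s else if u ∈ K then 0 else σ u
  let β' : α → ℕ := fun u => if u = v then ∑ w ∈ K, β w else if u ∈ K then 0 else β u
  have hne : ∀ u, u ∉ K → u ≠ v := fun u hu h => hu (h ▸ hvK)
  have hsumV : ∀ (f g : α → ℕ) (x : ℕ), (∀ u, u ∉ K → g u = f u) →
      (∀ u ∈ K, u ≠ v → g u = 0) → g v = x →
      ∑ u ∈ V, g u + ∑ u ∈ K, f u = ∑ u ∈ V, f u + x := by
    intro f g x h1 h2 h3
    rw [← Finset.sum_sdiff hKV, ← Finset.sum_sdiff (f := f) hKV,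
      Finset.sum_congr rfl (fun u hu => h1 u (Finset.mem_sdiff.1 hu).2),
      Finset.sum_eq_single_of_mem v hvK (fun u hu hne => h2 u hu hne), h3]
    ring
  have hmemL' : ∀ s' u, u ∉ K → (u ∈ L' s' ↔ u ∈ L s') := by
    intro s' u hu
    simp only [L']
    split_ifs with h
    · rfl
    · simp [hu, hne u hu]
  have hvL' : ∀ s', v ∈ L' s' ↔ ¬ Disjoint (L s') K := by
    intro s'
    simp only [L']
    split_ifs with h
    · simp only [h, not_true_eq_false, iff_false]
      exact fun hv => Finset.disjoint_left.1 h hv hvK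
    · simp [h]
  have hKL' : ∀ s' u, u ∈ K → u ≠ v → u ∉ L' s' := by
    intro s' u hu huv
    simp only [L']
    split_ifs with h
    · exact fun hv => Finset.disjoint_left.1 h hv hu
    · simp [hu, huv]
  have key := ih L' (S.erase s) c' σ' β' ?_ ?_ ?_ ?_ ?_ (by rw [Finset.card_erase_of_mem hs, hm]; rfl)
  · have b1 := hsumV c c' 0 (fun u hu => by simp [c', hu]) (fun u hu _ => by simp [c', hu])
      (by simp [c', hvK])
    have b2 := hsumV σ σ' (∑ w ∈ K, σ w + d s) (fun u hu => by simp [σ', hu, hne u hu])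
      (fun u hu h => by simp [σ', hu, h]) (by simp [σ'])
    have b3 := hsumV β β' (∑ w ∈ K, β w) (fun u hu => by simp [β', hu, hne u hu])
      (fun u hu h => by simp [β', hu, h]) (by simp [β'])
    have b4 := Finset.add_sum_erase S d hs
    rw [hcK, add_zero] at b1
    simp only [← Finset.mul_sum, Finset.sum_add_distrib] at key ⊢
    have b3' : ∑ u ∈ V, β' u = ∑ u ∈ V, β u := by omega
    have b5 : ∑ u ∈ V, σ' u + ∑ x ∈ S.erase s, d x = ∑ u ∈ V, σ u + ∑ x ∈ S, d x := by omega
    rw [b3', b5] at key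
    rw [← b1]
    linarith
  · intro s' hs' u hu
    by_cases huK : u ∈ K
    · exact hKV huK
    · exact hL s' (Finset.mem_of_mem_erase hs') ((hmemL' s' u huK).1 hu)
  · intro u hu
    by_cases huK : u ∈ K
    · left; simp [c', huK]
    · simpa [c', σ', huK, hne u huK] using hc u hu
  · intro u hu h0
    by_cases huv : u = v
    · simpa [σ', huv] using hnew
    · by_cases huK : u ∈ K
      · simp [σ', huv, huK]
      · simp only [c', huK, if_false] at h0
        simpa [σ', huv, huK] using hσ u hu h0
  · intro u hu
    by_cases huv : u = v
    · subst huv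
      have e1 : (S.erase s).filter (fun s' => u ∈ L' s') ⊆
          K.biUnion (fun w => (S.filter (fun s' => w ∈ L s')).erase s) := by
        intro s' hs'
        simp only [Finset.mem_filter, hvL', Finset.mem_erase] at hs'
        obtain ⟨w, h1, h2⟩ := Finset.not_disjoint_iff.1 hs'.2
        simp only [Finset.mem_biUnion, Finset.mem_erase, Finset.mem_filter]
        exact ⟨w, h2, hs'.1.1, hs'.1.2, h1⟩
      have e2 := (Finset.card_le_card e1).trans Finset.card_biUnion_le
      have e3 : ∑ w ∈ K, ((S.filter (fun s' => w ∈ L s')).erase s).card ≤ ∑ w ∈ K, (β w + c w) := by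
        refine Finset.sum_le_sum fun w hw => ?_
        rw [Finset.card_erase_of_mem (by simp [hs, ← hKdef, hw])]
        have := hdeg w (hKV hw)
        omega
      rw [Finset.sum_add_distrib, hcK] at e3
      simp only [β', c', hvK, if_true]
      omega
    · by_cases huK : u ∈ K
      · rw [Finset.filter_false_of_mem (fun s' _ => hKL' s' u huK huv)]
        simp
      · simp only [β', c', huK, huv, if_false, hmemL' _ u huK]
        refine le_trans (Finset.card_le_card ?_) (hdeg u hu)
        exact Finset.filter_subset_filter _ (Finset.erase_subset _ _)
  · intro A hA hsize
    have hAS : A ⊆ S := hA.trans (Finset.erase_subset _ _)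
    have hsA : s ∉ A := fun h => Finset.notMem_erase s S (hA h)
    by_cases hmeet : v ∈ A.biUnion L'
    · have e1 : A.biUnion L' = insert v (A.biUnion L \ K) := by
        ext u
        by_cases huv : u = v
        · subst huv; simpa using hmeet
        · by_cases huK : u ∈ K
          · simp [huv, huK, hKL' _ u huK huv]
          · simp [huv, huK, hmemL' _ u huK]
      have e2 : (insert s A).biUnion L = (A.biUnion L \ K) ∪ K := by
        rw [Finset.biUnion_insert, Finset.sdiff_union_self_eq_union, Finset.union_comm]
      have hvn : v ∉ A.biUnion L \ K := by simp [hvK]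
      have := hS (insert s A) (Finset.insert_subset hs hAS)
      rw [e2, Finset.sum_union Finset.sdiff_disjoint, Finset.sum_union Finset.sdiff_disjoint,
        Finset.sum_insert hsA, Finset.card_insert_of_notMem hsA, hcK] at this
      rw [e1, Finset.sum_insert hvn] at hsize ⊢
      have e3 : ∑ u ∈ A.biUnion L \ K, σ' u = ∑ u ∈ A.biUnion L \ K, σ u :=
        Finset.sum_congr rfl fun u hu => by
          have := (Finset.mem_sdiff.1 hu).2
          simp [σ', this, hne u this]
      have e4 : ∑ u ∈ A.biUnion L \ K, c' u = ∑ u ∈ A.biUnion L \ K, c u :=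
        Finset.sum_congr rfl fun u hu => by
          have := (Finset.mem_sdiff.1 hu).2
          simp [c', this]
      have e5 : σ' v = ∑ w ∈ K, σ w + d s := by simp [σ']
      have := this (by omega)
      omega
    · have e0 : ∀ u ∈ A.biUnion L, u ∉ K := by
        intro u hu huK
        obtain ⟨s', hs', hus'⟩ := Finset.mem_biUnion.1 hu
        exact hmeet (Finset.mem_biUnion.2 ⟨s', hs', (hvL' s').2
          (Finset.not_disjoint_iff.2 ⟨u, hus', huK⟩)⟩)
      have e1 : A.biUnion L' = A.biUnion L := by
        refine Finset.biUnion_congr rfl fun s' hs' => ?_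
        simp only [L']
        rw [if_pos]
        exact Finset.disjoint_left.2 fun u hu => e0 u (Finset.mem_biUnion.2 ⟨s', hs', hu⟩)
      rw [e1] at hsize ⊢
      have e3 : ∑ u ∈ A.biUnion L, σ' u = ∑ u ∈ A.biUnion L, σ u :=
        Finset.sum_congr rfl fun u hu => by simp [σ', e0 u hu, hne u (e0 u hu)]
      have e4 : ∑ u ∈ A.biUnion L, c' u = ∑ u ∈ A.biUnion L, c u :=
        Finset.sum_congr rfl fun u hu => by simp [c', e0 u hu]
      rw [e4]
      exact hS A hAS (by omega)

theorem exists_zeros_of_sum_add_two_le (n : ℕ → ℕ) (ℓ : ℕ)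
    (h : ∑ i ∈ Finset.range ℓ, n i + 2 ≤ ℓ)
    (hmid : ∀ a b, a < b → b < ℓ → n a = 0 → n b = 0 →
      b ≤ ∑ i ∈ Finset.Ico (a + 1) b, n i + a + 1) :
    ∃ a b, a < b ∧ b < ℓ ∧ n a = 0 ∧ n b = 0 ∧ ∑ i ∈ Finset.range b, n i + 1 ≤ b ∧
      ∑ i ∈ Finset.Ico (a + 1) ℓ, n i + a + 2 ≤ ℓ ∧ ℓ ≤ ∑ i ∈ Finset.range ℓ, n i + 2 := by
  set Z := (Finset.range ℓ).filter (fun i => n i = 0) with hZ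
  have hpos : ∀ K : Finset ℕ, (∀ i ∈ K, 1 ≤ n i) → K.card ≤ ∑ i ∈ K, n i := by
    intro K hK
    simpa using Finset.card_nsmul_le_sum K n 1 hK
  have hne : Z.Nonempty := by
    by_contra hcon
    have h1 := hpos (Finset.range ℓ) (fun i hi => by
      by_contra h0
      exact hcon ⟨i, by simp only [hZ, Finset.mem_filter]; exact ⟨hi, by omega⟩⟩)
    rw [Finset.card_range] at h1
    omega
  have ha := Finset.mem_filter.1 (Z.min'_mem hne)
  have hb := Finset.mem_filter.1 (Z.max'_mem hne)
  have hbefore : ∀ i < Z.min' hne, 1 ≤ n i := by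
    intro i hi
    by_contra h0
    have h1 := Finset.mem_range.1 ha.1
    have := Z.min'_le i (by simp only [hZ, Finset.mem_filter, Finset.mem_range]; omega)
    omega
  have hafter : ∀ i, Z.max' hne < i → i < ℓ → 1 ≤ n i := by
    intro i hi hil
    by_contra h0
    have := Z.le_max' i (by simp only [hZ, Finset.mem_filter, Finset.mem_range]; omega)
    omega
  have hab := Z.min'_le_max' hne
  generalize Z.min' hne = a at *
  generalize Z.max' hne = b at *
  simp only [Finset.mem_range] at ha hb
  have h1 := hpos (Finset.range a) (fun i hi => hbefore i (Finset.mem_range.1 hi))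
  have h2 := hpos (Finset.Ico (b + 1) ℓ) (fun i hi => by
    rw [Finset.mem_Ico] at hi; exact hafter i (by omega) (by omega))
  rw [Finset.card_range] at h1
  rw [Nat.card_Ico] at h2
  have s1 := Finset.sum_range_add_sum_Ico n (show b + 1 ≤ ℓ by omega)
  have s2 := Finset.sum_range_succ n b
  have s3 := Finset.sum_range_add_sum_Ico n (show a + 1 ≤ ℓ by omega)
  have s4 := Finset.sum_range_succ n a
  rcases hab.eq_or_lt with rfl | hlt
  · omega
  · have s5 := Finset.sum_range_add_sum_Ico n (show a + 1 ≤ b by omega)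
    have s6 := hmid a b hlt hb.1 ha.2 hb.2
    exact ⟨a, b, hlt, hb.1, ha.2, hb.2, by omega, by omega, by omega⟩

/-- The point at signed distance `r` from `p` on the diagonal through `p`. -/
def diagShift (p : ℤ × ℤ) (r : ℤ) : ℤ × ℤ := (p.1 + r, p.2 + r)

@[simp]
theorem diagShift_zero (p : ℤ × ℤ) : diagShift p 0 = p := by simp [diagShift]

theorem diagShift_diagShift (p : ℤ × ℤ) (r s : ℤ) :
    diagShift (diagShift p r) s = diagShift p (r + s) := by
  simp [diagShift, add_assoc]

theorem diagShift_injective (p : ℤ × ℤ) : Function.Injective (diagShift p) := fun r s h => by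
  simpa [diagShift] using h

/-- The points of `O` whose predecessor on the diagonal is not in `O`. -/
def diagStarts (O : Finset (ℤ × ℤ)) : Finset (ℤ × ℤ) := O.filter (fun o => diagShift o (-1) ∉ O)

theorem exists_diagStarts_length (O : Finset (ℤ × ℤ)) (N : ℕ)
    (hrun : ∀ p, ∀ ℓ : ℕ, (∀ r < ℓ, diagShift p (r : ℤ) ∈ O) → ℓ ≤ N) :
    ∃ len : ℤ × ℤ → ℕ, (∀ p, ∀ r < len p, diagShift p (r : ℤ) ∈ O) ∧
      (∀ p, diagShift p (len p : ℤ) ∉ O) ∧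
      ∀ o ∈ O, ∃ p ∈ diagStarts O, ∃ r < len p, diagShift p (r : ℤ) = o := by
  classical
  have h1 : ∀ p, ∃ r : ℕ, diagShift p (r : ℤ) ∉ O := by
    intro p
    by_contra hcon
    push Not at hcon
    have := hrun p (N + 1) (fun r _ => hcon r)
    omega
  have hmem : ∀ p, ∀ r < Nat.find (h1 p), diagShift p (r : ℤ) ∈ O := fun p r hr => by
    simpa using Nat.find_min (h1 p) hr
  refine ⟨fun p => Nat.find (h1 p), hmem, fun p => Nat.find_spec (h1 p), fun o ho => ?_⟩
  have h2 : ∃ j : ℕ, diagShift o (-(j : ℤ)) ∉ O := by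
    by_contra hcon
    push Not at hcon
    have := hrun (diagShift o (-(N : ℤ))) (N + 1) (fun r hr => by
      rw [diagShift_diagShift]
      have := hcon (N - r)
      rwa [show (-((N - r : ℕ) : ℤ)) = -(N : ℤ) + r by omega] at this)
    omega
  obtain ⟨j, hj⟩ : ∃ j, Nat.find h2 = j + 1 := Nat.exists_eq_succ_of_ne_zero fun h => by
    have := Nat.find_spec h2
    rw [h] at this
    simp [ho] at this
  have hback : ∀ i ≤ j, diagShift o (-(i : ℤ)) ∈ O := fun i hi => by
    simpa using Nat.find_min h2 (show i < Nat.find h2 by omega)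
  have hspec := Nat.find_spec h2
  rw [hj] at hspec
  refine ⟨diagShift o (-(j : ℤ)), ?_, j, ?_, ?_⟩
  · refine Finset.mem_filter.2 ⟨hback j le_rfl, ?_⟩
    rw [diagShift_diagShift]
    convert hspec using 3
    push_cast
    ring
  · by_contra hlt
    push Not at hlt
    apply Nat.find_spec (h1 (diagShift o (-(j : ℤ))))
    rw [diagShift_diagShift]
    generalize Nat.find (h1 (diagShift o (-(j : ℤ)))) = m at *
    have := hback (j - m) (by omega)
    rwa [show (-((j - m : ℕ) : ℤ)) = -(j : ℤ) + m by omega] at this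
  · rw [diagShift_diagShift]
    simp

theorem eq_of_diagShift_eq_diagShift {O : Finset (ℤ × ℤ)} {len : ℤ × ℤ → ℕ}
    (hlen : ∀ p, ∀ r < len p, diagShift p (r : ℤ) ∈ O) {p q : ℤ × ℤ}
    (hp : p ∈ diagStarts O) (hq : q ∈ diagStarts O) {r s : ℕ} (hr : r < len p) (hs : s < len q)
    (h : diagShift p (r : ℤ) = diagShift q (s : ℤ)) : p = q := by
  have aux : ∀ {p q : ℤ × ℤ}, p ∈ diagStarts O → ∀ {r s : ℕ}, s < len q → r ≤ s →
      diagShift p (r : ℤ) = diagShift q (s : ℤ) → p = q := by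
    intro p q hp r s hs hrs h
    have h1 : p = diagShift q ((s : ℤ) - r) := by
      have := congrArg (fun x => diagShift x (-(r : ℤ))) h
      simpa [diagShift_diagShift, sub_eq_add_neg] using this
    rcases hrs.eq_or_lt with rfl | hlt
    · simpa using h1
    · exfalso
      apply (Finset.mem_filter.1 hp).2
      rw [h1, diagShift_diagShift]
      have := hlen q (s - r - 1) (by omega)
      rwa [show ((s - r - 1 : ℕ) : ℤ) = (s : ℤ) - r + -1 by omega] at this
  rcases le_total r s with hrs | hrs
  · exact aux hp hs hrs h
  · exact (aux hq hr hrs h.symm).symm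

theorem sum_biUnion_diagShift {O : Finset (ℤ × ℤ)} {len : ℤ × ℤ → ℕ}
    (hlen : ∀ p, ∀ r < len p, diagShift p (r : ℤ) ∈ O) (J : ℤ × ℤ → Finset ℕ)
    (hJ : ∀ p ∈ diagStarts O, ∀ r ∈ J p, r < len p) (f : ℤ × ℤ → ℕ) :
    ∑ o ∈ (diagStarts O).biUnion (fun p => (J p).image (fun r : ℕ => diagShift p (r : ℤ))), f o =
      ∑ p ∈ diagStarts O, ∑ r ∈ J p, f (diagShift p (r : ℤ)) := by
  rw [Finset.sum_biUnion]
  · refine Finset.sum_congr rfl fun p _ => ?_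
    rw [Finset.sum_image]
    intro r _ s _ h
    exact_mod_cast diagShift_injective p h
  · intro p hp q hq hpq
    refine Finset.disjoint_left.2 fun o ho ho' => hpq ?_
    obtain ⟨r, hr, rfl⟩ := Finset.mem_image.1 ho
    obtain ⟨s, hs, h⟩ := Finset.mem_image.1 ho'
    exact eq_of_diagShift_eq_diagShift hlen hp hq (hJ p hp r hr) (hJ q hq s hs) h.symm

/-- The number of coordinates of `o` used by elements of `M`. -/
def incidence (M : Finset (ℤ × ℤ)) (o : ℤ × ℤ) : ℕ :=
  (M.filter (fun e => e.1 = o.1)).card + (M.filter (fun e => e.2 = o.2)).card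

/-- The elements of `M` one of whose coordinates differs by `r` from that of `o`. -/
def atDistance (M : Finset (ℤ × ℤ)) (o : ℤ × ℤ) (r : ℤ) : Finset (ℤ × ℤ) :=
  M.filter (fun e => e.1 = o.1 + r ∨ e.2 = o.2 + r)

theorem card_atDistance_zero_le (M : Finset (ℤ × ℤ)) (o : ℤ × ℤ) :
    (atDistance M o 0).card ≤ incidence M o := by
  unfold atDistance incidence
  simp only [add_zero]
  rw [Finset.filter_or]
  exact Finset.card_union_le _ _

theorem atDistance_diagShift (M : Finset (ℤ × ℤ)) (o : ℤ × ℤ) (r s : ℤ) :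
    atDistance M (diagShift o r) s = atDistance M o (r + s) := by
  simp [atDistance, diagShift, add_assoc]

theorem atDistance_eq_empty (M : Finset (ℤ × ℤ)) (o : ℤ × ℤ) (r : ℤ)
    (h : incidence M (diagShift o r) = 0) : atDistance M o r = ∅ := by
  have := card_atDistance_zero_le M (diagShift o r)
  rw [h, atDistance_diagShift, add_zero] at this
  exact Finset.card_eq_zero.1 (Nat.le_zero.1 this)

/-- Every `Y ⊆ O` with at most `t` elements meets at least as many elements of `M`, where two
points meet when they are at distance at most one in one of the coordinates. -/
def LocallyDominated (M O : Finset (ℤ × ℤ)) (t : ℕ) : Prop :=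
  ∀ Y ⊆ O, Y.card ≤ t → Y.card ≤
    (Y.biUnion (fun o => atDistance M o (-1) ∪ atDistance M o 0 ∪ atDistance M o 1)).card

theorem LocallyDominated.card_le {M O : Finset (ℤ × ℤ)} {T : ℕ}
    (h : LocallyDominated M O (T + 1)) (Y Z : Finset (ℤ × ℤ)) (hY : Y ⊆ O)
    (hr : ∀ o ∈ Y, diagShift o 1 ∈ Y ∨ atDistance M o 1 ⊆ Z)
    (hl : ∀ o ∈ Y, diagShift o (-1) ∈ Y ∨ atDistance M o (-1) ⊆ Z)
    (hT : Z.card + ∑ o ∈ Y, incidence M o ≤ T) :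
    Y.card ≤ Z.card + ∑ o ∈ Y, incidence M o := by
  by_contra hcon
  obtain ⟨X, hXY, hX⟩ := Finset.exists_subset_card_eq
    (show Z.card + ∑ o ∈ Y, incidence M o + 1 ≤ Y.card by omega)
  have h1 := h X (hXY.trans hY) (by omega)
  have h2 : X.biUnion (fun o => atDistance M o (-1) ∪ atDistance M o 0 ∪ atDistance M o 1) ⊆
      Z ∪ Y.biUnion (fun o => atDistance M o 0) := by
    have side : ∀ o ∈ Y, ∀ r, diagShift o r ∈ Y ∨ atDistance M o r ⊆ Z →
        atDistance M o r ⊆ Z ∪ Y.biUnion (fun o => atDistance M o 0) := by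
      rintro o ho r (h3 | h3)
      · refine Finset.Subset.trans ?_ Finset.subset_union_right
        have := Finset.subset_biUnion_of_mem (fun o => atDistance M o 0) h3
        simpa [atDistance_diagShift] using this
      · exact h3.trans Finset.subset_union_left
    refine Finset.biUnion_subset.2 fun o ho => ?_
    have hoY := hXY ho
    exact Finset.union_subset (Finset.union_subset (side o hoY _ (hl o hoY))
      (side o hoY 0 (Or.inl (by simpa using hoY)))) (side o hoY _ (hr o hoY))
  have h3 := (Finset.card_le_card h2).trans (Finset.card_union_le _ _)
  have h4 : (Y.biUnion (fun o => atDistance M o 0)).card ≤ ∑ o ∈ Y, incidence M o :=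
    Finset.card_biUnion_le.trans (Finset.sum_le_sum fun o _ => card_atDistance_zero_le M o)
  omega

/-- The number of incidences of `M` with the run of `ℓ` points at `p`. -/
def runIncidence (M : Finset (ℤ × ℤ)) (p : ℤ × ℤ) (ℓ : ℕ) : ℕ :=
  ∑ r ∈ Finset.range ℓ, incidence M (diagShift p (r : ℤ))

/-- The elements of `M` adjacent to an end of the run of `ℓ` points at `p`. A run with slack two is
split into a left part (`false`) and a right part (`true`), each having one end. -/
def endNeighbors (M : Finset (ℤ × ℤ)) (ℓ : ℕ) (p : ℤ × ℤ) : Bool → Finset (ℤ × ℤ)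
  | true => atDistance M p ℓ
  | false => if runIncidence M p ℓ + 2 ≤ ℓ then atDistance M p (-1)
      else atDistance M p (-1) ∪ atDistance M p ℓ

theorem LocallyDominated.exists_parts {M O : Finset (ℤ × ℤ)} {T : ℕ}
    (h : LocallyDominated M O (T + 1)) (p : ℤ × ℤ) (ℓ : ℕ) (hℓ : ℓ ≤ T + 1)
    (hO : ∀ r < ℓ, diagShift p (r : ℤ) ∈ O) :
    ℓ ≤ runIncidence M p ℓ + 2 ∧
    ∃ J : Bool → Finset ℕ,
      (∀ x, runIncidence M p ℓ + 1 + x.toNat ≤ ℓ →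
        J x ⊆ Finset.range ℓ ∧
        (∀ r ∈ J x, r + 1 ∈ J x ∨ atDistance M p (r + 1) ⊆ endNeighbors M ℓ p x) ∧
        (∀ r ∈ J x, (∃ s ∈ J x, r = s + 1) ∨ atDistance M p (r - 1) ⊆ endNeighbors M ℓ p x) ∧
        ∑ r ∈ J x, incidence M (diagShift p (r : ℤ)) + 1 ≤ (J x).card) ∧
      (runIncidence M p ℓ + 2 ≤ ℓ → J false ∪ J true = Finset.range ℓ) := by
  by_cases h2 : runIncidence M p ℓ + 2 ≤ ℓ
  · obtain ⟨a, b, hab, hb, hna, hnb, hsb, hsa, htot⟩ := exists_zeros_of_sum_add_two_le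
      (fun r => incidence M (diagShift p (r : ℤ))) ℓ h2 (by
        intro a b hab hb hna hnb
        set Y := (Finset.Ico (a + 1) b).image (fun r : ℕ => diagShift p (r : ℤ)) with hY
        have hinj : Function.Injective (fun r : ℕ => diagShift p (r : ℤ)) := fun r s hrs => by
          exact_mod_cast diagShift_injective p hrs
        have hsum : ∑ o ∈ Y, incidence M o =
            ∑ r ∈ Finset.Ico (a + 1) b, incidence M (diagShift p (r : ℤ)) :=
          Finset.sum_image fun r _ s _ hrs => hinj hrs
        have hcard : Y.card = b - (a + 1) := by
          rw [hY, Finset.card_image_of_injective _ hinj, Nat.card_Ico]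
        by_contra hcon
        have := h.card_le Y ∅ (by
            intro o ho
            obtain ⟨r, hr, rfl⟩ := Finset.mem_image.1 ho
            exact hO r (by rw [Finset.mem_Ico] at hr; omega))
          (by
            intro o ho
            obtain ⟨r, hr, rfl⟩ := Finset.mem_image.1 ho
            rw [Finset.mem_Ico] at hr
            rw [diagShift_diagShift, atDistance_diagShift]
            by_cases hr' : r + 1 = b
            · right
              rw [atDistance_eq_empty]
              rw [← hnb, ← hr']
              norm_cast
            · left
              refine Finset.mem_image.2 ⟨r + 1, ?_, by norm_cast⟩
              rw [Finset.mem_Ico]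
              omega)
          (by
            intro o ho
            obtain ⟨r, hr, rfl⟩ := Finset.mem_image.1 ho
            rw [Finset.mem_Ico] at hr
            obtain ⟨s, rfl⟩ : ∃ s, r = s + 1 := ⟨r - 1, by omega⟩
            rw [diagShift_diagShift, atDistance_diagShift,
              show ((s + 1 : ℕ) : ℤ) + -1 = s by push_cast; ring]
            by_cases hs : s = a
            · right
              rw [atDistance_eq_empty]
              rw [← hna, ← hs]
            · left
              refine Finset.mem_image.2 ⟨s, ?_, rfl⟩
              rw [Finset.mem_Ico]
              omega)
          (by rw [hsum, Finset.card_empty]; omega)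
        rw [hsum, hcard, Finset.card_empty] at this
        omega)
    refine ⟨htot, fun x => if x then Finset.Ico (a + 1) ℓ else Finset.range b, ?_, ?_⟩
    · rintro (_ | _) -
      · simp only [Bool.false_eq_true, if_false, endNeighbors, if_pos h2, Finset.mem_range]
        refine ⟨Finset.range_subset_range.2 hb.le, fun r hr => ?_, fun r hr => ?_, ?_⟩
        · by_cases hr' : r + 1 = b
          · right
            rw [atDistance_eq_empty]
            · simp
            · rw [← hnb, ← hr']
              norm_cast
          · left
            omega
        · rcases r with _ | r
          · right; simp
          · left
            exact ⟨r, by omega, rfl⟩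
        · simpa using hsb
      · simp only [if_true, endNeighbors, Finset.mem_Ico]
        refine ⟨fun r hr => ?_, fun r hr => ?_, fun r hr => ?_, ?_⟩
        · rw [Finset.mem_Ico] at hr
          rw [Finset.mem_range]
          exact hr.2
        · by_cases hr' : r + 1 = ℓ
          · right
            rw [← hr']
            norm_cast
          · left
            omega
        · obtain ⟨s, rfl⟩ : ∃ s, r = s + 1 := ⟨r - 1, by omega⟩
          by_cases hs : s = a
          · right
            rw [atDistance_eq_empty]
            · simp
            · rw [← hna, ← hs]
              simp
          · left
            exact ⟨s, by omega, rfl⟩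
        · rw [Nat.card_Ico]
          omega
    · intro _
      ext r
      simp only [Bool.false_eq_true, if_false, if_true, Finset.mem_union, Finset.mem_range,
        Finset.mem_Ico]
      omega
  · refine ⟨by omega, fun _ => Finset.range ℓ, ?_, fun h' => absurd h' h2⟩
    rintro (_ | _) hx
    · simp only [endNeighbors, if_neg h2, Finset.mem_range]
      refine ⟨Finset.Subset.rfl, fun r hr => ?_, fun r hr => ?_, ?_⟩
      · by_cases hr' : r + 1 = ℓ
        · right
          rw [← hr']
          norm_cast
          exact Finset.subset_union_right
        · left
          omega
      · rcases r with _ | r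
        · right
          simp
        · left
          exact ⟨r, by omega, rfl⟩
      · simpa [runIncidence] using hx
    · simp only [Bool.toNat_true] at hx
      omega

theorem sum_incidence_comm (M O : Finset (ℤ × ℤ)) :
    ∑ o ∈ O, incidence M o = ∑ e ∈ M, incidence O e := by
  have aux : ∀ π : ℤ × ℤ → ℤ, ∑ o ∈ O, (M.filter (fun e => π e = π o)).card =
      ∑ e ∈ M, (O.filter (fun o => π o = π e)).card := by
    intro π
    have := Finset.sum_card_bipartiteAbove_eq_sum_card_bipartiteBelow
      (s := O) (t := M) (fun o e => π e = π o)
    simpa [Finset.bipartiteAbove, Finset.bipartiteBelow, eq_comm] using this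
  unfold incidence
  rw [Finset.sum_add_distrib, Finset.sum_add_distrib, aux Prod.fst, aux Prod.snd]

theorem card_filter_ends_le {O : Finset (ℤ × ℤ)} {π : ℤ × ℤ → ℤ}
    (hπ : ∀ p r, π (diagShift p r) = π p + r)
    (hinj : ∀ o ∈ O, ∀ o' ∈ O, π o = π o' → o = o')
    (hcons : ∀ o ∈ O, ∀ o' ∈ O, π o' = π o + 1 → o' = diagShift o 1)
    {len : ℤ × ℤ → ℕ} (hlen : ∀ p, ∀ r < len p, diagShift p (r : ℤ) ∈ O)
    (hend : ∀ p, diagShift p (len p : ℤ) ∉ O)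
    {S : Finset ((ℤ × ℤ) × Bool)} (hS : ∀ s ∈ S, s.1 ∈ diagStarts O ∧ 0 < len s.1)
    (g : ℤ × ℤ → Bool) (x : ℤ) :
    (S.filter (fun s => s.2 = false ∧ x = π s.1 + -1)).card +
      (S.filter (fun s => s.2 = g s.1 ∧ x = π s.1 + len s.1)).card +
      2 * (O.filter (fun o => π o = x)).card ≤ 2 := by
  have hlast : ∀ s ∈ S, diagShift s.1 ((len s.1 - 1 : ℕ) : ℤ) ∈ O := fun s hs =>
    hlen _ _ (by have := (hS s hs).2; omega)
  have h0 : (O.filter (fun o => π o = x)).card ≤ 1 := by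
    refine Finset.card_le_one.2 fun o ho o' ho' => ?_
    rw [Finset.mem_filter] at ho ho'
    exact hinj o ho.1 o' ho'.1 (ho.2.trans ho'.2.symm)
  have h1 : (S.filter (fun s => s.2 = false ∧ x = π s.1 + -1)).card ≤ 1 := by
    refine Finset.card_le_one.2 fun s hs s' hs' => ?_
    rw [Finset.mem_filter] at hs hs'
    refine Prod.ext (hinj _ (Finset.mem_filter.1 (hS s hs.1).1).1 _
      (Finset.mem_filter.1 (hS s' hs'.1).1).1 ?_) (hs.2.1.trans hs'.2.1.symm)
    have := hs.2.2
    have := hs'.2.2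
    omega
  have h2 : (S.filter (fun s => s.2 = g s.1 ∧ x = π s.1 + len s.1)).card ≤ 1 := by
    refine Finset.card_le_one.2 fun s hs s' hs' => ?_
    rw [Finset.mem_filter] at hs hs'
    have e1 := (hS s hs.1).2
    have e2 := (hS s' hs'.1).2
    have e3 := hinj _ (hlast s hs.1) _ (hlast s' hs'.1) (by
      rw [hπ, hπ]
      have := hs.2.2
      have := hs'.2.2
      omega)
    have e4 := eq_of_diagShift_eq_diagShift hlen (hS s hs.1).1 (hS s' hs'.1).1
      (by omega) (by omega) e3
    exact Prod.ext e4 (by rw [hs.2.1, hs'.2.1, e4])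
  rcases (O.filter (fun o => π o = x)).eq_empty_or_nonempty with h | ⟨o, ho⟩
  · rw [h]
    simp only [Finset.card_empty]
    omega
  · rw [Finset.mem_filter] at ho
    rw [Finset.filter_false_of_mem, Finset.filter_false_of_mem]
    · simp only [Finset.card_empty]
      omega
    · rintro s hs ⟨-, h⟩
      have e1 := (hS s hs).2
      apply hend s.1
      have := hcons _ (hlast s hs) o ho.1 (by rw [hπ]; omega)
      rw [diagShift_diagShift, show ((len s.1 - 1 : ℕ) : ℤ) + 1 = len s.1 by omega] at this
      exact this ▸ ho.1
    · rintro s hs ⟨-, h⟩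
      have e1 := Finset.mem_filter.1 (hS s hs).1
      apply e1.2
      have := hcons o ho.1 _ e1.1 (by omega)
      rw [this, diagShift_diagShift]
      simpa using ho.1

theorem LocallyDominated.mul_card_le {M O : Finset (ℤ × ℤ)} {T : ℕ}
    (h : LocallyDominated M O (T + 1))
    (hfst : ∀ o ∈ O, ∀ o' ∈ O, o.1 = o'.1 → o = o')
    (hsnd : ∀ o ∈ O, ∀ o' ∈ O, o.2 = o'.2 → o = o')
    (hfst' : ∀ o ∈ O, ∀ o' ∈ O, o'.1 = o.1 + 1 → o' = diagShift o 1)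
    (hsnd' : ∀ o ∈ O, ∀ o' ∈ O, o'.2 = o.2 + 1 → o' = diagShift o 1)
    (hrun : ∀ p, ∀ ℓ : ℕ, (∀ r < ℓ, diagShift p (r : ℤ) ∈ O) → ℓ ≤ T + 1) :
    T * O.card ≤ (2 * T + 4) * M.card := by
  classical
  obtain ⟨len, hlen, hend, hcov⟩ := exists_diagStarts_length O (T + 1) hrun
  choose hslack J hJ hJunion using fun p =>
    h.exists_parts p (len p) (hrun p _ (hlen p)) (hlen p)
  set S := diagStarts O with hSdef
  set items := (S ×ˢ (Finset.univ : Finset Bool)).filter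
    (fun s => runIncidence M s.1 (len s.1) + 1 + s.2.toNat ≤ len s.1) with hitems
  have hmem : ∀ s ∈ items, s.1 ∈ S ∧ runIncidence M s.1 (len s.1) + 1 + s.2.toNat ≤ len s.1 := by
    intro s hs
    simpa [hitems] using hs
  let L : (ℤ × ℤ) × Bool → Finset (ℤ × ℤ) := fun s => endNeighbors M (len s.1) s.1 s.2
  let d : (ℤ × ℤ) × Bool → ℕ := fun s =>
    ∑ r ∈ J s.1 s.2, incidence M (diagShift s.1 (r : ℤ))
  have hLM : ∀ s, L s ⊆ M := by
    rintro ⟨p, _ | _⟩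
    · simp only [L, endNeighbors]
      split_ifs
      · exact Finset.filter_subset _ _
      · exact Finset.union_subset (Finset.filter_subset _ _) (Finset.filter_subset _ _)
    · exact Finset.filter_subset _ _
  have hfiber : ∀ A ⊆ items, ∀ f : (ℤ × ℤ) × Bool → ℕ, ∑ s ∈ A, f s =
      ∑ p ∈ S, ∑ x ∈ Finset.univ.filter (fun x => (p, x) ∈ A), f (p, x) := by
    intro A hA f
    refine Finset.sum_finset_product A S _ fun s => ?_
    simp only [Finset.mem_filter, Finset.mem_univ, true_and, iff_and_self]
    exact fun hs => (hmem s (hA hs)).1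
  have hdeg : ∀ v, (items.filter (fun s => v ∈ L s)).card + 2 * incidence O v ≤ 4 := by
    intro v
    have hS : ∀ s ∈ items, s.1 ∈ diagStarts O ∧ 0 < len s.1 := fun s hs =>
      ⟨(hmem s hs).1, by have := (hmem s hs).2; omega⟩
    let g : ℤ × ℤ → Bool := fun p => decide (runIncidence M p (len p) + 2 ≤ len p)
    have h1 := card_filter_ends_le (π := Prod.fst) (fun _ _ => rfl) hfst hfst' hlen hend hS g v.1
    have h2 := card_filter_ends_le (π := Prod.snd) (fun _ _ => rfl) hsnd hsnd' hlen hend hS g v.2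
    have h3 : items.filter (fun s => v ∈ L s) ⊆
        (items.filter (fun s => s.2 = false ∧ v.1 = s.1.1 + -1) ∪
          items.filter (fun s => s.2 = g s.1 ∧ v.1 = s.1.1 + len s.1)) ∪
        (items.filter (fun s => s.2 = false ∧ v.2 = s.1.2 + -1) ∪
          items.filter (fun s => s.2 = g s.1 ∧ v.2 = s.1.2 + len s.1)) := by
      rintro ⟨p, x⟩ hs
      obtain ⟨hs, hv⟩ := Finset.mem_filter.1 hs
      have hx := (hmem _ hs).2
      simp only [Finset.mem_union, Finset.mem_filter, hs, true_and, g]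
      cases x
      · simp only [L, endNeighbors] at hv
        split_ifs at hv with hlt
        · have := (Finset.mem_filter.1 hv).2
          simp only [hlt]
          tauto
        · simp only [hlt]
          rcases Finset.mem_union.1 hv with hv | hv <;>
            have := (Finset.mem_filter.1 hv).2 <;> simp <;> tauto
      · have hlt : runIncidence M p (len p) + 2 ≤ len p := hx
        have := (Finset.mem_filter.1 (show v ∈ atDistance M p (len p) from hv)).2
        simp only [hlt]
        simp
        tauto
    have h4 := Finset.card_le_card h3
    have h5 := Finset.card_union_le (items.filter (fun s => s.2 = false ∧ v.1 = s.1.1 + -1))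
      (items.filter (fun s => s.2 = g s.1 ∧ v.1 = s.1.1 + len s.1))
    have h6 := Finset.card_union_le (items.filter (fun s => s.2 = false ∧ v.2 = s.1.2 + -1))
      (items.filter (fun s => s.2 = g s.1 ∧ v.2 = s.1.2 + len s.1))
    have h7 := h4.trans (Finset.card_union_le _ _)
    unfold incidence
    omega
  let c : ℤ × ℤ → ℕ := fun v => if incidence O v < 2 then 1 else 0
  have key := card_le_of_forall_card_le_cost T M L items d c c (fun v => 2 - 2 * incidence O v)
    (fun s _ => hLM s)
    (fun v _ => by simp only [c]; split_ifs <;> simp)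
    (fun v _ h0 => by omega)
    (fun v _ => by
      have := hdeg v
      simp only [c]
      split_ifs <;> omega)
    (by
      intro A hA hsize
      let B : ℤ × ℤ → Finset Bool := fun p => Finset.univ.filter (fun x => (p, x) ∈ A)
      let U : ℤ × ℤ → Finset ℕ := fun p => (B p).biUnion (J p)
      have hBmem : ∀ p, ∀ x ∈ B p, (p, x) ∈ A := fun p x hx => (Finset.mem_filter.1 hx).2
      have hU : ∀ p ∈ S, ∀ r ∈ U p, r < len p := by
        intro p _ r hr
        obtain ⟨x, hx, hr⟩ := Finset.mem_biUnion.1 hr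
        exact Finset.mem_range.1 ((hJ p x (hmem _ (hA (hBmem p x hx))).2).1 hr)
      set Y := S.biUnion (fun p => (U p).image (fun r : ℕ => diagShift p (r : ℤ))) with hY
      have hYsum : ∀ f : ℤ × ℤ → ℕ,
          ∑ o ∈ Y, f o = ∑ p ∈ S, ∑ r ∈ U p, f (diagShift p (r : ℤ)) :=
        sum_biUnion_diagShift hlen U hU
      have hYcard : Y.card = ∑ p ∈ S, (U p).card := by
        simpa using hYsum (fun _ => 1)
      have hAcard : A.card = ∑ p ∈ S, (B p).card := by
        have := hfiber A hA (fun _ => 1)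
        simpa only [Finset.sum_const, smul_eq_mul, mul_one] using this
      have hcost : ∑ v ∈ A.biUnion L, c v = (A.biUnion L).card := by
        rw [Finset.card_eq_sum_ones]
        refine Finset.sum_congr rfl fun v hv => ?_
        obtain ⟨s, hs, hv⟩ := Finset.mem_biUnion.1 hv
        have h1 : 0 < (items.filter (fun s => v ∈ L s)).card :=
          Finset.card_pos.2 ⟨s, Finset.mem_filter.2 ⟨hA hs, hv⟩⟩
        have h2 := hdeg v
        simp only [c]
        rw [if_pos (by omega)]
      have hcases : ∀ X : Finset Bool, X = ∅ ∨ X = {false} ∨ X = {true} ∨ X = {false, true} := by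
        decide
      have hgain : ∀ p, (B p).card + ∑ r ∈ U p, incidence M (diagShift p (r : ℤ)) ≤ (U p).card := by
        intro p
        have hone : ∀ x ∈ B p, _ := fun x hx => (hJ p x (hmem _ (hA (hBmem p x hx))).2).2.2.2
        simp only [U]
        rcases hcases (B p) with hB | hB | hB | hB
        · simp [hB]
        · have := hone false (by simp [hB])
          rw [hB, Finset.singleton_biUnion, Finset.card_singleton]
          omega
        · have := hone true (by simp [hB])
          rw [hB, Finset.singleton_biUnion, Finset.card_singleton]
          omega
        · have h1 : runIncidence M p (len p) + 2 ≤ len p :=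
            (hmem _ (hA (hBmem p true (by simp [hB])))).2
          rw [hB, Finset.biUnion_insert, Finset.singleton_biUnion, hJunion p h1, Finset.card_range]
          simp only [runIncidence] at h1
          simpa [add_comm] using h1
      have hload : ∀ p, ∑ r ∈ U p, incidence M (diagShift p (r : ℤ)) ≤ ∑ x ∈ B p, d (p, x) := by
        intro p
        simp only [U, d]
        rcases hcases (B p) with hB | hB | hB | hB
        · simp [hB]
        · simp [hB]
        · simp [hB]
        · rw [hB, Finset.biUnion_insert, Finset.singleton_biUnion, Finset.sum_pair (by simp),
            ← Finset.sum_union_inter]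
          exact Nat.le_add_right _ _
      have hd : ∑ o ∈ Y, incidence M o ≤ ∑ s ∈ A, d s := by
        rw [hYsum, hfiber A hA]
        exact Finset.sum_le_sum fun p _ => hload p
      have hYO : Y ⊆ O := by
        intro o ho
        obtain ⟨p, hp, ho⟩ := Finset.mem_biUnion.1 ho
        obtain ⟨r, hr, rfl⟩ := Finset.mem_image.1 ho
        exact hlen p r (hU p hp r hr)
      have hYmem : ∀ o ∈ Y, ∃ p ∈ S, ∃ x ∈ B p, ∃ r ∈ J p x, diagShift p (r : ℤ) = o := by
        intro o ho
        obtain ⟨p, hp, ho⟩ := Finset.mem_biUnion.1 ho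
        obtain ⟨r, hr, rfl⟩ := Finset.mem_image.1 ho
        obtain ⟨x, hx, hr⟩ := Finset.mem_biUnion.1 hr
        exact ⟨p, hp, x, hx, r, hr, rfl⟩
      have hmemY : ∀ p ∈ S, ∀ x ∈ B p, ∀ r ∈ J p x, diagShift p (r : ℤ) ∈ Y := by
        intro p hp x hx r hr
        exact Finset.mem_biUnion.2 ⟨p, hp, Finset.mem_image.2
          ⟨r, Finset.mem_biUnion.2 ⟨x, hx, hr⟩, rfl⟩⟩
      have hbound := h.card_le Y (A.biUnion L) hYO
        (by
          intro o ho
          obtain ⟨p, hp, x, hx, r, hr, rfl⟩ := hYmem o ho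
          have hxA := hBmem p x hx
          rw [diagShift_diagShift, atDistance_diagShift]
          rcases (hJ p x (hmem _ (hA hxA)).2).2.1 r hr with h1 | h1
          · left
            exact_mod_cast hmemY p hp x hx _ h1
          · right
            exact h1.trans (Finset.subset_biUnion_of_mem L hxA))
        (by
          intro o ho
          obtain ⟨p, hp, x, hx, r, hr, rfl⟩ := hYmem o ho
          have hxA := hBmem p x hx
          rw [diagShift_diagShift, atDistance_diagShift]
          rcases (hJ p x (hmem _ (hA hxA)).2).2.2.1 r hr with ⟨s, hs, rfl⟩ | h1
          · left
            simpa using hmemY p hp x hx s hs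
          · right
            exact h1.trans (Finset.subset_biUnion_of_mem L hxA))
        (by omega)
      have hgains := Finset.sum_le_sum (fun p (_ : p ∈ S) => hgain p)
      rw [Finset.sum_add_distrib, ← hYsum, ← hAcard, ← hYcard] at hgains
      omega)
  have hOeq : O = S.biUnion (fun p => (Finset.range (len p)).image
      (fun r : ℕ => diagShift p (r : ℤ))) := by
    ext o
    simp only [Finset.mem_biUnion, Finset.mem_image, Finset.mem_range]
    refine ⟨fun ho => hcov o ho, ?_⟩
    rintro ⟨p, -, r, hr, rfl⟩
    exact hlen p r hr
  have hOsum := sum_biUnion_diagShift hlen (fun p => Finset.range (len p))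
    (fun p _ r hr => Finset.mem_range.1 hr)
  have hOcard : O.card = ∑ p ∈ S, len p := by
    have := hOsum (fun _ => 1)
    rw [← hSdef, ← hOeq] at this
    simpa using this
  have hOinc : ∑ e ∈ M, incidence O e = ∑ p ∈ S, runIncidence M p (len p) := by
    have := hOsum (incidence M)
    rw [← hSdef, ← hOeq, sum_incidence_comm] at this
    exact this
  have hB : ∀ p ∈ S, Finset.univ.filter (fun x => (p, x) ∈ items) =
      Finset.univ.filter (fun x : Bool => runIncidence M p (len p) + 1 + x.toNat ≤ len p) := by
    intro p hp
    ext x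
    simp [hitems, hp]
  have hcount : O.card ≤ ∑ e ∈ M, incidence O e + items.card := by
    have h1 := hfiber items Finset.Subset.rfl (fun _ => 1)
    rw [Finset.sum_const, smul_eq_mul, mul_one] at h1
    rw [hOcard, hOinc, h1, ← Finset.sum_add_distrib]
    refine Finset.sum_le_sum fun p hp => ?_
    rw [hB p hp]
    have h2 := hslack p
    by_cases h3 : runIncidence M p (len p) + 2 ≤ len p
    · rw [Finset.filter_true_of_mem]
      · simpa using h2
      · rintro (_ | _) - <;> simp only [Bool.toNat_true, Bool.toNat_false] <;> omega
    · by_cases h4 : runIncidence M p (len p) + 1 ≤ len p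
      · have : 1 ≤ (Finset.univ.filter
            (fun x : Bool => runIncidence M p (len p) + 1 + x.toNat ≤ len p)).card :=
          Finset.card_pos.2 ⟨false, by simpa using h4⟩
        rw [Finset.sum_const, smul_eq_mul, mul_one]
        omega
      · omega
  have hdtot : ∑ s ∈ items, d s ≤ 2 * ∑ e ∈ M, incidence O e := by
    rw [hfiber items Finset.Subset.rfl, hOinc, Finset.mul_sum]
    refine Finset.sum_le_sum fun p hp => ?_
    have h1 : ∀ x ∈ Finset.univ.filter (fun x => (p, x) ∈ items),
        d (p, x) ≤ runIncidence M p (len p) := by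
      intro x hx
      exact Finset.sum_le_sum_of_subset
        (hJ p x (hmem _ (Finset.mem_filter.1 hx).2).2).1
    refine (Finset.sum_le_card_nsmul _ _ _ h1).trans ?_
    rw [smul_eq_mul]
    exact Nat.mul_le_mul_right _ (Finset.card_le_univ _)
  have hV1 : ∑ v ∈ M, (2 - 2 * incidence O v + 2 * c v) + 2 * ∑ v ∈ M, incidence O v ≤
      4 * M.card := by
    rw [Finset.mul_sum, ← Finset.sum_add_distrib, mul_comm, ← smul_eq_mul]
    refine Finset.sum_le_card_nsmul _ _ _ fun v _ => ?_
    have := hdeg v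
    simp only [c]
    split_ifs <;> omega
  have hV2 : ∑ v ∈ M, c v + 2 * ∑ v ∈ M, incidence O v ≤ 4 * M.card := by
    rw [Finset.mul_sum, ← Finset.sum_add_distrib, mul_comm, ← smul_eq_mul]
    refine Finset.sum_le_card_nsmul _ _ _ fun v _ => ?_
    have := hdeg v
    simp only [c]
    split_ifs <;> omega
  rw [← Finset.mul_sum] at key
  have e1 := Nat.mul_le_mul_left T hcount
  have e2 := Nat.mul_le_mul_left T hV1
  nlinarith

theorem LocallyOptimal.card_le_card_overlap_s14 {n : ℕ} {E M O Y : Finset (Fin n × Fin n)} {t : ℕ}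
    (hM : LocallyOptimal E M t) (hO : ConsecMatching E O) (hY : Y ⊆ O) (hYt : Y.card ≤ t) :
    Y.card ≤ (M.filter (fun e => ∃ o ∈ Y, Overlap e o)).card := by
  set N := M.filter (fun e => ∃ o ∈ Y, Overlap e o) with hN
  by_contra hcon
  push Not at hcon
  have hYM : Y ∩ M ⊆ N := fun e he => by
    obtain ⟨h1, h2⟩ := Finset.mem_inter.1 he
    exact Finset.mem_filter.2 ⟨h2, e, h1, Or.inl (by simp)⟩
  have hrem : (N \ Y).card + (Y ∩ M).card = N.card := by
    rw [← Finset.card_sdiff_add_card_inter N Y]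
    congr 2
    ext e
    simp only [Finset.mem_inter]
    exact ⟨fun h => ⟨hYM (Finset.mem_inter.2 h), h.1⟩, fun h => ⟨h.2, (Finset.mem_filter.1 h.1).1⟩⟩
  have hadd := Finset.card_sdiff_add_card_inter Y M
  refine hM.2 ⟨N \ Y, Y \ M, Finset.sdiff_subset.trans (Finset.filter_subset _ _),
    Finset.sdiff_subset_sdiff (hY.trans hO.1) Finset.Subset.rfl, by omega, by omega, ?_⟩
  have hmem : ∀ e ∈ (M \ (N \ Y)) ∪ (Y \ M), e ∈ Y ∨ (e ∈ M ∧ ∀ o ∈ Y, ¬ Overlap e o) := by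
    intro e he
    by_cases heY : e ∈ Y
    · exact Or.inl heY
    · right
      simp only [Finset.mem_union, Finset.mem_sdiff, heY, false_and, not_false_eq_true, and_true,
        or_false] at he
      refine ⟨he.1, fun o ho hov => he.2 ?_⟩
      exact Finset.mem_filter.2 ⟨he.1, o, ho, hov⟩
  obtain ⟨hME, hM1, hM2, hM3⟩ := hM.1
  obtain ⟨hOE, hO1, hO2, hO3⟩ := hO
  refine ⟨?_, ?_, ?_, ?_⟩
  · intro e he
    rcases hmem e he with h | h
    · exact hOE (hY h)
    · exact hME h.1
  · intro e he e' he' hne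
    rcases hmem e he with h | h <;> rcases hmem e' he' with h' | h'
    · exact hO1 e (hY h) e' (hY h') hne
    · have := h'.2 e h
      unfold Overlap at this
      simp only [ne_eq, Fin.ext_iff]
      omega
    · have := h.2 e' h'
      unfold Overlap at this
      simp only [ne_eq, Fin.ext_iff]
      omega
    · exact hM1 e h.1 e' h'.1 hne
  · intro e he e' he' hs
    rcases hmem e he with h | h <;> rcases hmem e' he' with h' | h'
    · exact hO2 e (hY h) e' (hY h') hs
    · have := h'.2 e h
      unfold Overlap at this
      omega
    · have := h.2 e' h'
      unfold Overlap at this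
      omega
    · exact hM2 e h.1 e' h'.1 hs
  · intro e he e' he' hs
    rcases hmem e he with h | h <;> rcases hmem e' he' with h' | h'
    · exact hO3 e (hY h) e' (hY h') hs
    · have := h'.2 e h
      unfold Overlap at this
      omega
    · have := h.2 e' h'
      unfold Overlap at this
      omega
    · exact hM3 e h.1 e' h'.1 hs

/-- The edge `(i, j)` as a point of the integer lattice. -/
def latticePoint {n : ℕ} (e : Fin n × Fin n) : ℤ × ℤ := (e.1.val, e.2.val)

theorem latticePoint_injective {n : ℕ} : Function.Injective (latticePoint (n := n)) := by
  rintro ⟨a, b⟩ ⟨a', b'⟩ h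
  simpa [latticePoint, Fin.ext_iff] using h

theorem LocallyOptimal.locallyDominated {n : ℕ} {E M O : Finset (Fin n × Fin n)} {t : ℕ}
    (hM : LocallyOptimal E M t) (hO : ConsecMatching E O) :
    LocallyDominated (M.image latticePoint) (O.image latticePoint) t := by
  intro Y hY hYt
  obtain ⟨X, hXO, rfl⟩ := Finset.subset_image_iff.1 hY
  rw [Finset.card_image_of_injective _ latticePoint_injective] at hYt ⊢
  refine (hM.card_le_card_overlap_s14 hO hXO hYt).trans ?_
  rw [← Finset.card_image_of_injective _ latticePoint_injective]
  refine Finset.card_le_card (Finset.image_subset_iff.2 fun e he => ?_)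
  obtain ⟨heM, o, ho, hov⟩ := Finset.mem_filter.1 he
  refine Finset.mem_biUnion.2 ⟨_, Finset.mem_image_of_mem _ ho, ?_⟩
  simp only [atDistance, Finset.mem_union, Finset.mem_filter, Finset.mem_image_of_mem _ heM,
    true_and]
  unfold Overlap at hov
  simp only [latticePoint]
  omega

theorem NoRun.lt_of_run {n : ℕ} {E O : Finset (Fin n × Fin n)} {k : ℕ} (hE : NoRun E k)
    (hO : O ⊆ E) (p : ℤ × ℤ) (ℓ : ℕ)
    (h : ∀ r < ℓ, diagShift p (r : ℤ) ∈ O.image latticePoint) : ℓ < k ∨ k = 0 := by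
  by_contra hcon
  push Not at hcon
  obtain ⟨hkl, hk⟩ := hcon
  have hget : ∀ r < k, ∃ e ∈ O, (e.1.val : ℤ) = p.1 + r ∧ (e.2.val : ℤ) = p.2 + r := by
    intro r hr
    obtain ⟨e, he, heq⟩ := Finset.mem_image.1 (h r (by omega))
    exact ⟨e, he, congrArg Prod.fst heq, congrArg Prod.snd heq⟩
  obtain ⟨e, -, h1, h2⟩ := hget 0 (by omega)
  obtain ⟨e', -, h3, h4⟩ := hget (k - 1) (by omega)
  have h5 := e'.1.isLt
  have h6 := e'.2.isLt
  refine hE ⟨O.filter (fun o => ∃ r < k, o.1.val = e.1.val + r ∧ o.2.val = e.2.val + r),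
    ⟨e.1.val, e.2.val, by omega, by omega, fun o => ?_⟩, (Finset.filter_subset _ _).trans hO⟩
  simp only [Finset.mem_filter, and_iff_right_iff_imp]
  rintro ⟨r, hr, hr1, hr2⟩
  obtain ⟨o', ho', h7, h8⟩ := hget r hr
  have : o = o' := Prod.ext (Fin.ext (by omega)) (Fin.ext (by omega))
  exact this ▸ ho'

/-- if `E` contains no run of `⌈2/ε⌉` consecutive edges and `M` is a
`(⌈4/ε⌉ + 1)`-locally-optimal consecutive matching in `E`, then
`(2 + ε)·|M| ≥ |O|` for every consecutive matching `O` in `E`. -/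
theorem local_search_two_plus_eps {n : ℕ} (hn : 1 ≤ n) (ε : ℝ) (hε : 0 < ε)
    (E : Finset (Fin n × Fin n)) (hE : NoRun E ⌈2 / ε⌉₊)
    (M : Finset (Fin n × Fin n)) (hM : LocallyOptimal E M (⌈4 / ε⌉₊ + 1))
    (O : Finset (Fin n × Fin n)) (hO : ConsecMatching E O) :
    (2 + ε) * (M.card : ℝ) ≥ (O.card : ℝ) := by
  set T := ⌈4 / ε⌉₊ with hT
  have hceil : 4 / ε ≤ T := Nat.le_ceil _
  have hTpos : (0 : ℝ) < T := lt_of_lt_of_le (by positivity) hceil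
  have hk : ⌈2 / ε⌉₊ ≤ T := Nat.ceil_mono (by gcongr; norm_num)
  have hk0 : ⌈2 / ε⌉₊ ≠ 0 := (Nat.ceil_pos.2 (by positivity)).ne'
  have hinj : ∀ o ∈ O, ∀ o' ∈ O, o.1 = o'.1 ∨ o.2 = o'.2 → o = o' := by
    intro o ho o' ho' h
    by_contra hne
    have := hO.2.1 o ho o' ho' hne
    tauto
  have key := (hM.locallyDominated hO).mul_card_le
    (by
      simp only [Finset.forall_mem_image]
      intro o ho o' ho' h
      rw [hinj o ho o' ho' (Or.inl (Fin.ext (by simpa [latticePoint] using h)))])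
    (by
      simp only [Finset.forall_mem_image]
      intro o ho o' ho' h
      rw [hinj o ho o' ho' (Or.inr (Fin.ext (by simpa [latticePoint] using h)))])
    (by
      simp only [Finset.forall_mem_image]
      intro o ho o' ho' h
      simp only [latticePoint, diagShift] at h ⊢
      have := hO.2.2.1 o ho o' ho' (by omega)
      ext <;> simp only <;> omega)
    (by
      simp only [Finset.forall_mem_image]
      intro o ho o' ho' h
      simp only [latticePoint, diagShift] at h ⊢
      have := hO.2.2.2 o ho o' ho' (by omega)
      ext <;> simp only <;> omega)
    (by
      intro p ℓ h
      have := hE.lt_of_run hO.1 p ℓ h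
      omega)
  rw [Finset.card_image_of_injective _ latticePoint_injective,
    Finset.card_image_of_injective _ latticePoint_injective] at key
  have key' : (T : ℝ) * O.card ≤ (2 * T + 4) * M.card := by exact_mod_cast key
  have h4 : 4 ≤ ε * T := by rwa [div_le_iff₀' hε] at hceil
  have h5 : (T : ℝ) * O.card ≤ T * ((2 + ε) * M.card) := by
    nlinarith [mul_le_mul_of_nonneg_right h4 (Nat.cast_nonneg (α := ℝ) M.card)]
  exact le_of_mul_le_mul_left h5 hTpos
end
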